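/- arXiv:2205.14365 — 6 statements merged into one kernel-verified Lean document; each statement's English description precedes it below -/
import Mathlib

section
/- For all reals 0 ≤ s < t ≤ 1, the function ν_{s,t} satisfies the condition RV: for every δ ∈ [0,1] and all subsets a, b, c of H, if c ⊆ a, a ⊆ b and ν_{s,t}(b,c) ≥ δ, then ν_{s,t}(a,c) ≥ δ. -/
/-- The classical rough inclusion function on subsets of a finite set `H`:
`ν(A,B) = #(A∩B)/#(A)` if `A ≠ ∅`, and `1` otherwise. -/
noncomputable def nu {H : Type*} [DecidableEq H] (A B : Finset H) : ℝ :=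
  if A = ∅ then 1 else ((A ∩ B).card : ℝ) / (A.card : ℝ)

/-- `ν_{s,t}(A,B)`: `0` if `ν(A,B) ≤ s`; `(ν(A,B) − s)/(t − s)` if `s < ν(A,B) < t`;
`1` if `ν(A,B) ≥ t`. -/
noncomputable def nust {H : Type*} [DecidableEq H] (s t : ℝ) (A B : Finset H) : ℝ :=
  if nu A B ≤ s then 0 else if nu A B < t then (nu A B - s) / (t - s) else 1

theorem nu_le_one {H : Type*} [DecidableEq H] (A B : Finset H) : nu A B ≤ 1 := by
  unfold nu
  split_ifs
  · exact le_rfl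
  · exact div_le_one_of_le₀ (by exact_mod_cast Finset.card_le_card Finset.inter_subset_left)
      (Nat.cast_nonneg _)

theorem nu_le_nu_of_subset {H : Type*} [DecidableEq H] {a b c : Finset H}
    (hca : c ⊆ a) (hab : a ⊆ b) : nu b c ≤ nu a c := by
  rcases a.eq_empty_or_nonempty with rfl | ha
  · simpa [nu] using nu_le_one b c
  · have hb : b.Nonempty := ha.mono hab
    have hcard : (a.card : ℝ) ≤ b.card := by exact_mod_cast Finset.card_le_card hab
    have hpos : (0 : ℝ) < a.card := by exact_mod_cast ha.card_pos
    rw [nu, nu, if_neg hb.ne_empty, if_neg ha.ne_empty, Finset.inter_eq_right.2 hca,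
      Finset.inter_eq_right.2 (hca.trans hab)]
    gcongr

theorem nust_le_nust_of_nu_le_nu {H : Type*} [DecidableEq H] {s t : ℝ} (hst : s < t)
    {A B C D : Finset H} (h : nu A B ≤ nu C D) : nust s t A B ≤ nust s t C D := by
  have hd : 0 < t - s := sub_pos.2 hst
  unfold nust
  split_ifs
  all_goals first
    | linarith
    | exact div_nonneg (by linarith) hd.le
    | exact (div_le_one hd).2 (by linarith)
    | gcongr

/-- For all reals `0 ≤ s < t ≤ 1`, the function `ν_{s,t}` satisfies RV:
for every `δ ∈ [0,1]` and all subsets `a, b, c` of `H`, if `c ⊆ a`, `a ⊆ b` and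
`ν_{s,t}(b,c) ≥ δ`, then `ν_{s,t}(a,c) ≥ δ`. -/
theorem nust_satisfies_RV {H : Type*} [Fintype H] [DecidableEq H]
    (s t : ℝ) (hs : 0 ≤ s) (hst : s < t) (ht : t ≤ 1)
    (δ : ℝ) (hδ : δ ∈ Set.Icc (0 : ℝ) 1) (a b c : Finset H)
    (hca : c ⊆ a) (hab : a ⊆ b) (hbc : δ ≤ nust s t b c) : δ ≤ nust s t a c :=
  hbc.trans (nust_le_nust_of_nu_le_nu hst (nu_le_nu_of_subset hca hab))
end

section
/- For all reals 0 ≤ s < t ≤ 1, the function ν_{s,t} satisfies the condition RI: for every δ ∈ [0,1] and all subsets a, b, c of H, if ν_{s,t}(a,c) ≥ δ, ν_{s,t}(b,c) ≥ δ and c ⊆ a ∩ b, then ν_{s,t}(a∩b, c) ≥ δ. -/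
/-- Shrinking the first argument to a set that still contains the second does not decrease `nu`. -/
theorem nu_le_nu_of_subset_s3 {H : Type*} [DecidableEq H] {A A' B : Finset H}
    (hBA' : B ⊆ A') (hA'A : A' ⊆ A) : nu A B ≤ nu A' B := by
  unfold nu
  rw [Finset.inter_eq_right.mpr hBA', Finset.inter_eq_right.mpr (hBA'.trans hA'A)]
  by_cases hA' : A' = ∅
  · rw [if_pos hA']
    split_ifs
    · rfl
    · exact div_le_one_of_le₀ (mod_cast Finset.card_le_card (hBA'.trans hA'A)) (by positivity)
  · have hpos : 0 < A'.card := Finset.card_pos.mpr (Finset.nonempty_iff_ne_empty.mpr hA')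
    have hA : A ≠ ∅ := fun h => hA' (Finset.subset_empty.mp (h ▸ hA'A))
    rw [if_neg hA, if_neg hA']
    gcongr

/-- `nust s t A B` is monotone in `nu A B`. -/
theorem nust_le_nust_of_nu_le {H : Type*} [DecidableEq H] {s t : ℝ} (hst : s < t)
    {A A' B B' : Finset H} (h : nu A B ≤ nu A' B') : nust s t A B ≤ nust s t A' B' := by
  have hts : 0 < t - s := sub_pos.mpr hst
  unfold nust
  split_ifs
  any_goals linarith
  · exact div_nonneg (by linarith) hts.le
  · gcongr
  · rw [div_le_one hts]
    linarith

/-- For all reals `0 ≤ s < t ≤ 1`, the function `ν_{s,t}` satisfies RI: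
for every `δ ∈ [0,1]` and all subsets `a, b, c` of `H`, if `ν_{s,t}(a,c) ≥ δ`,
`ν_{s,t}(b,c) ≥ δ` and `c ⊆ a ∩ b`, then `ν_{s,t}(a∩b, c) ≥ δ`. -/
theorem nust_satisfies_RI {H : Type*} [Fintype H] [DecidableEq H]
    (s t : ℝ) (hs : 0 ≤ s) (hst : s < t) (ht : t ≤ 1)
    (δ : ℝ) (hδ : δ ∈ Set.Icc (0 : ℝ) 1) (a b c : Finset H)
    (hac : δ ≤ nust s t a c) (hbc : δ ≤ nust s t b c) (hcab : c ⊆ a ∩ b) :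
    δ ≤ nust s t (a ∩ b) c := by
  exact hac.trans (nust_le_nust_of_nu_le hst
    (nu_le_nu_of_subset_s3 hcab Finset.inter_subset_left))
end

section
/- For all reals 0 ≤ s < t ≤ 1, the function ν_{s,t} is a weak quasi rough inclusion function, i.e. it satisfies R0 and R3; moreover, when t = 1, the function ν_{s,1} is a quasi rough inclusion function, i.e. it additionally satisfies R2. -/
/-- R0: `a ⊆ b` implies `κ(a,b) = 1`. -/
def satR0 {H : Type*} (κ : Finset H → Finset H → ℝ) : Prop :=
  ∀ a b : Finset H, a ⊆ b → κ a b = 1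

/-- R2: `κ(b,c) = 1` implies `κ(a,b) ≤ κ(a,c)`. -/
def satR2 {H : Type*} (κ : Finset H → Finset H → ℝ) : Prop :=
  ∀ a b c : Finset H, κ b c = 1 → κ a b ≤ κ a c

/-- R3: `b ⊆ c` implies `κ(a,b) ≤ κ(a,c)`. -/
def satR3 {H : Type*} (κ : Finset H → Finset H → ℝ) : Prop :=
  ∀ a b c : Finset H, b ⊆ c → κ a b ≤ κ a c

section

variable {H : Type*} [DecidableEq H]

theorem nu_eq_one_of_subset {A B : Finset H} (h : A ⊆ B) : nu A B = 1 := by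
  unfold nu
  split_ifs with hA
  · rfl
  · rw [Finset.inter_eq_left.mpr h]
    exact div_self (by simpa using hA)

theorem nu_mono_right (A : Finset H) {B C : Finset H} (h : B ⊆ C) : nu A B ≤ nu A C := by
  unfold nu
  split_ifs
  · rfl
  · gcongr

theorem subset_of_one_le_nu {A B : Finset H} (h : 1 ≤ nu A B) : A ⊆ B := by
  unfold nu at h
  split_ifs at h with hA
  · simp [hA]
  · have hpos : (0 : ℝ) < A.card := by
      exact_mod_cast Finset.card_pos.mpr (Finset.nonempty_iff_ne_empty.mpr hA)
    have hcard : A.card ≤ (A ∩ B).card := by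
      rw [le_div_iff₀ hpos, one_mul] at h
      exact_mod_cast h
    exact Finset.inter_eq_left.mp (Finset.eq_of_subset_of_card_le Finset.inter_subset_left hcard)

theorem satR0_nust {s t : ℝ} (hst : s < t) (ht : t ≤ 1) : satR0 (nust (H := H) s t) := by
  intro a b h
  rw [nust, nu_eq_one_of_subset h, if_neg (by linarith), if_neg (by linarith)]

theorem satR3_nust {s t : ℝ} (hst : s < t) : satR3 (nust (H := H) s t) := by
  intro a b c h
  have hmono := nu_mono_right a h
  have hpos : 0 < t - s := sub_pos.mpr hst
  unfold nust
  split_ifs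
  all_goals first
    | linarith
    | exact div_nonneg (by linarith) hpos.le
    | exact (div_le_one hpos).mpr (by linarith)
    | gcongr

theorem le_nu_of_nust_eq_one {s t : ℝ} (hst : s < t) {A B : Finset H}
    (h : nust s t A B = 1) : t ≤ nu A B := by
  unfold nust at h
  split_ifs at h with hs ht
  · norm_num at h
  · rw [div_eq_one_iff_eq (sub_pos.mpr hst).ne'] at h
    linarith
  · exact not_lt.mp ht

end

/-- For all reals `0 ≤ s < t ≤ 1`, `ν_{s,t}` is a weak quasi-RIF (satisfies R0 and R3),
and `ν_{s,1}` is a quasi-RIF (additionally satisfies R2). -/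
theorem nust_wqRIF_and_qRIF {H : Type*} [Fintype H] [DecidableEq H]
    (s t : ℝ) (hs : 0 ≤ s) (hst : s < t) (ht : t ≤ 1) :
    (satR0 (nust (H := H) s t) ∧ satR3 (nust (H := H) s t)) ∧
      satR2 (nust (H := H) s 1) := by
  exact ⟨⟨satR0_nust hst ht, satR3_nust hst⟩, fun a b c h =>
    have hs1 : s < 1 := hst.trans_le ht
    satR3_nust hs1 a b c (subset_of_one_le_nu (le_nu_of_nust_eq_one hs1 h))⟩
end

section
/- Idempotence of the lower VPRS approximation: let α ∈ (0, 1/2) and let κ satisfy RV at level 1−α. Then for every subset a of H: a^{lα} ⊆ a, and (a^{lα})^{lα} = a^{lα}. -/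
/-- The lower VPRS approximation of `B`:
`B^{lα} = ⋃ {h ∈ 𝒢 : h ⊆ B and κ(B,h) ≥ 1−α}`. -/
def lowerVPRS {H : Type*} (G : Set (Set H)) (κ : Set H → Set H → ℝ) (α : ℝ)
    (B : Set H) : Set H :=
  ⋃₀ {h | h ∈ G ∧ h ⊆ B ∧ 1 - α ≤ κ B h}

/-- `κ` satisfies RV at level `δ`: `c ⊆ a`, `a ⊆ b` and `κ(b,c) ≥ δ` imply `κ(a,c) ≥ δ`. -/
def satRVat {H : Type*} (κ : Set H → Set H → ℝ) (δ : ℝ) : Prop :=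
  ∀ a b c : Set H, c ⊆ a → a ⊆ b → δ ≤ κ b c → δ ≤ κ a c

theorem lowerVPRS_subset {H : Type*} (G : Set (Set H)) (κ : Set H → Set H → ℝ) (α : ℝ)
    (B : Set H) : lowerVPRS G κ α B ⊆ B :=
  Set.sUnion_subset fun _ hh => hh.2.1

/-- Idempotence of the lower VPRS approximation: if `α ∈ (0, 1/2)` and `κ` satisfies RV
at level `1−α`, then for every `a ⊆ H`: `a^{lα} ⊆ a` and `(a^{lα})^{lα} = a^{lα}`. -/
theorem lowerVPRS_idempotent {H : Type*} [Fintype H]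
    (G : Set (Set H)) (κ : Set H → Set H → ℝ) (α : ℝ)
    (hα : α ∈ Set.Ioo (0 : ℝ) (1 / 2)) (hRV : satRVat κ (1 - α)) :
    ∀ a : Set H, lowerVPRS G κ α a ⊆ a ∧
      lowerVPRS G κ α (lowerVPRS G κ α a) = lowerVPRS G κ α a := by
  intro a
  refine ⟨lowerVPRS_subset G κ α a, (lowerVPRS_subset G κ α _).antisymm ?_⟩
  refine Set.sUnion_subset fun h hh => Set.subset_sUnion_of_mem ?_
  have h_le : h ⊆ lowerVPRS G κ α a := Set.subset_sUnion_of_mem hh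
  exact ⟨hh.1, h_le, hRV _ a h h_le (lowerVPRS_subset G κ α a) hh.2.2⟩
end

section
/- Cautious monotony for the starred lower VPRS approximation: let α ∈ (0, 1/2) and let κ satisfy RV at level 1−α. Then for all subsets a, b of H, if a^{lα*} ⊆ b and b ⊆ a, then a^{lα*} ⊆ b^{lα*}. -/
/-- The starred (peripatetic) lower VPRS approximation of `B`:
`B^{lα*} = ⋃ {h ∈ 𝒢 : κ(B,h) ≥ 1−α}`. -/
def lowerVPRSstar {H : Type*} (G : Set (Set H)) (κ : Set H → Set H → ℝ) (α : ℝ)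
    (B : Set H) : Set H :=
  ⋃₀ {h | h ∈ G ∧ 1 - α ≤ κ B h}

/-- Cautious monotony for the starred lower VPRS approximation: if `α ∈ (0, 1/2)` and
`κ` satisfies RV at level `1−α`, then `a^{lα*} ⊆ b ⊆ a` implies `a^{lα*} ⊆ b^{lα*}`. -/
theorem lowerVPRSstar_cautious_monotony {H : Type*} [Fintype H]
    (G : Set (Set H)) (κ : Set H → Set H → ℝ) (α : ℝ)
    (hα : α ∈ Set.Ioo (0 : ℝ) (1 / 2)) (hRV : satRVat κ (1 - α)) :
    ∀ a b : Set H, lowerVPRSstar G κ α a ⊆ b → b ⊆ a →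
      lowerVPRSstar G κ α a ⊆ lowerVPRSstar G κ α b := by
  rintro a b hab hba x ⟨h, ⟨hG, hκ⟩, hx⟩
  have hb : h ⊆ b := fun y hy => hab ⟨h, ⟨hG, hκ⟩, hy⟩
  exact ⟨h, ⟨hG, hRV b a h hb hba hκ⟩, hx⟩
end

section
/- Correspondence between starred upper VPRS approximations and graded upper approximations: let α ∈ (0, 1/2), let κ be the classical rough inclusion function ν, and let x ⊆ H be nonempty. Then x^{uα*} = x^{u_k} for the grade k = ⌊α·#(x)⌋. Consequently, the subsets of H can be partitioned into finitely many classes according to the value ⌊α·#(x)⌋, and on each class the starred upper VPRS approximation coincides with a single graded upper approximation. -/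
/-- The starred upper VPRS approximation (with `κ = ν`) of `x`:
`x^{uα*} = ⋃ {h ∈ 𝒢 : ν(x,h) > α}`. -/
def upperVPRSstar {H : Type*} [DecidableEq H] (G : Set (Finset H)) (α : ℝ)
    (x : Finset H) : Set H :=
  {y | ∃ h ∈ G, α < nu x h ∧ y ∈ h}

/-- The `k`-graded upper approximation of `x`: `x^{u_k} = ⋃ {h ∈ 𝒢 : #(h ∩ x) > k}`. -/
def gradedUpper {H : Type*} [DecidableEq H] (G : Set (Finset H)) (k : ℕ)
    (x : Finset H) : Set H :=
  {y | ∃ h ∈ G, k < (h ∩ x).card ∧ y ∈ h}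

theorem lt_nu_iff {H : Type*} [DecidableEq H] {α : ℝ} (hα : 0 ≤ α) {x : Finset H}
    (hx : x.Nonempty) (h : Finset H) :
    α < nu x h ↔ ⌊α * (x.card : ℝ)⌋₊ < (h ∩ x).card := by
  have hcard : (0 : ℝ) < x.card := by exact_mod_cast hx.card_pos
  rw [nu, if_neg hx.ne_empty, lt_div_iff₀ hcard, Nat.floor_lt (by positivity),
    Finset.inter_comm]

/-- Correspondence between starred upper VPRS approximations and graded upper
approximations: for `α ∈ (0, 1/2)`, `κ = ν` and nonempty `x ⊆ H`, the approximation
`x^{uα*}` equals `x^{u_k}` for the grade `k = ⌊α·#(x)⌋`; consequently the subsets of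
`H` fall into finitely many classes according to the value `⌊α·#(x)⌋`, on each of which
the starred upper VPRS approximation is a single graded upper approximation. -/
theorem upperVPRSstar_eq_gradedUpper {H : Type*} [Fintype H] [DecidableEq H]
    (G : Set (Finset H)) (α : ℝ) (hα : α ∈ Set.Ioo (0 : ℝ) (1 / 2))
    (x : Finset H) (hx : x.Nonempty) :
    upperVPRSstar G α x = gradedUpper G (⌊α * (x.card : ℝ)⌋₊) x ∧
    (Set.range fun y : Finset H => ⌊α * (y.card : ℝ)⌋₊).Finite := by
  refine ⟨?_, Set.finite_range _⟩
  simp only [upperVPRSstar, gradedUpper, lt_nu_iff hα.1.le hx]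
end
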